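/- arXiv:1710.00154 — 2 statements merged into one kernel-verified Lean document; each statement's English description precedes it below -/
import Mathlib

section
/- Every solution (A, V, W, M) of the Fourier-side ODE system satisfies the exact identity (1/2)(d/dt)[ |ξ|²|A|² − 2|ξ| Re(A V̄) ] + |ξ|²|A|² − |ξ|²|V|² + |ξ| Re( (I·(iξM)) Ā ) = 0 for all t ≥ 0, where V̄ and Ā denote complex conjugates. -/
noncomputable section

open scoped ComplexConjugate

/-- Euclidean space `ℝ^d`. -/
abbrev Ed (d : ℕ) := EuclideanSpace ℝ (Fin d)

/-- `I·ξ = ∑_k ξ_k I_k`. -/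
def IdotXi {d : ℕ} (ξ I : Ed d) : ℝ := ∑ k, ξ k * I k

/-- `I·(iξM) = ∑_{k,j} i ξ_k I_j M_{kj}`. -/
def IxiM {d : ℕ} (ξ I : Ed d) (M : Fin d → Fin d → ℂ) : ℂ :=
  ∑ k, ∑ j, Complex.I * (ξ k : ℂ) * (I j : ℂ) * M k j

/-- The Fourier-side ODE system:
`A′ + |ξ|V = 0`, `V′ + |ξ|²V − |ξ|A − I·(iξM) = 0`,
`W′ + μ_∞|ξ|²W − i(I·ξ)M = 0`, `M′ + |ξ|²M + iΓV − i(I·ξ)W = 0`,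
where `Γ_{ij} = ξ_j I_i − ξ_i I_j`. -/
structure FourierODE (d : ℕ) (μinf : ℝ) (ξ I : Ed d)
    (A V : ℝ → ℂ) (W M : ℝ → Fin d → Fin d → ℂ) : Prop where
  hA : ∀ t : ℝ, 0 ≤ t → HasDerivAt A (-((‖ξ‖ : ℂ) * V t)) t
  hV : ∀ t : ℝ, 0 ≤ t → HasDerivAt V
    (-((‖ξ‖ : ℂ) ^ 2 * V t) + (‖ξ‖ : ℂ) * A t + IxiM ξ I (M t)) t
  hW : ∀ t : ℝ, 0 ≤ t → ∀ i j : Fin d, HasDerivAt (fun τ => W τ i j)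
    (-((μinf : ℂ) * (‖ξ‖ : ℂ) ^ 2 * W t i j)
      + Complex.I * (IdotXi ξ I : ℂ) * M t i j) t
  hM : ∀ t : ℝ, 0 ≤ t → ∀ i j : Fin d, HasDerivAt (fun τ => M τ i j)
    (-((‖ξ‖ : ℂ) ^ 2 * M t i j)
      - Complex.I * ((ξ j * I i - ξ i * I j : ℝ) : ℂ) * V t
      + Complex.I * (IdotXi ξ I : ℂ) * W t i j) t

/-- Squared norm `|(A,V,W,M)|² = |A|² + |V|² + |W|² + |M|²` (Frobenius norms on matrices). -/
def sqnorm4 {d : ℕ} (A V : ℂ) (W M : Fin d → Fin d → ℂ) : ℝ :=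
  Complex.normSq A + Complex.normSq V
    + (∑ i, ∑ j, Complex.normSq (W i j)) + (∑ i, ∑ j, Complex.normSq (M i j))

/-- the exact cross identity
`(1/2)(d/dt)[|ξ|²|A|² − 2|ξ|Re(AV̄)] + |ξ|²|A|² − |ξ|²|V|² + |ξ|Re((I·(iξM))Ā) = 0`. -/
theorem stmt7 (d : ℕ) (μinf : ℝ) (hμ : 0 < μinf) (ξ I : Ed d) (hI : ‖I‖ = 1)
    (A V : ℝ → ℂ) (W M : ℝ → Fin d → Fin d → ℂ)
    (hode : FourierODE d μinf ξ I A V W M) :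
    ∀ t : ℝ, 0 ≤ t → ∀ D : ℝ,
      HasDerivAt
        (fun τ => ‖ξ‖ ^ 2 * Complex.normSq (A τ) - 2 * ‖ξ‖ * (A τ * conj (V τ)).re) D t →
      (1/2) * D + ‖ξ‖ ^ 2 * Complex.normSq (A t) - ‖ξ‖ ^ 2 * Complex.normSq (V t)
        + ‖ξ‖ * (IxiM ξ I (M t) * conj (A t)).re = 0 := by
  intro t ht D hD
  have re_deriv : ∀ {f : ℝ → ℂ} {f' : ℂ}, HasDerivAt f f' t →
      HasDerivAt (fun τ => (f τ).re) f'.re t := fun h =>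
    Complex.reCLM.hasFDerivAt.comp_hasDerivAt t h
  have im_deriv : ∀ {f : ℝ → ℂ} {f' : ℂ}, HasDerivAt f f' t →
      HasDerivAt (fun τ => (f τ).im) f'.im t := fun h =>
    Complex.imCLM.hasFDerivAt.comp_hasDerivAt t h
  have hAre := re_deriv (hode.hA t ht)
  have hAim := im_deriv (hode.hA t ht)
  have hVre := re_deriv (hode.hV t ht)
  have hVim := im_deriv (hode.hV t ht)
  have hE := (((hAre.mul hAre).add (hAim.mul hAim)).const_mul (‖ξ‖ ^ 2)).sub
    (((hAre.mul hVre).add (hAim.mul hVim)).const_mul (2 * ‖ξ‖))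
  have hD_eq := hD.unique (hE.congr_of_eventuallyEq (Filter.Eventually.of_forall fun τ => by
    simp [Complex.normSq_apply]))
  rw [hD_eq]
  generalize IxiM ξ I (M t) = Q
  simp only [← Complex.ofReal_pow, Complex.normSq_apply, Complex.add_re, Complex.add_im,
    Complex.neg_re, Complex.neg_im, Complex.mul_re, Complex.mul_im, Complex.ofReal_re,
    Complex.ofReal_im, Complex.conj_re, Complex.conj_im]
  ring
end
end

section
/- Let s₁, s₂, θ be real numbers with 0 ≤ s₁ ≤ s₂, s₂ > 1 and 0 ≤ θ < 1. Then there is a constant C = C(s₁, s₂, θ) such that for all t ≥ 0, ∫₀ᵗ ⟨t−τ⟩^{−s₁} τ^{−θ} ⟨τ⟩^{θ−s₂} dτ ≤ C ⟨t⟩^{−s₁}, where ⟨t⟩ := √(1+t²). -/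
noncomputable section

/-- Japanese bracket `⟨t⟩ = √(1+t²)`. -/
def jap (t : ℝ) : ℝ := Real.sqrt (1 + t ^ 2)

open MeasureTheory Set

theorem one_le_jap (t : ℝ) : 1 ≤ jap t :=
  Real.one_le_sqrt.2 (by nlinarith [sq_nonneg t])

theorem jap_pos (t : ℝ) : 0 < jap t := one_pos.trans_le (one_le_jap t)

theorem jap_le_one_add {t : ℝ} (ht : 0 ≤ t) : jap t ≤ 1 + t :=
  Real.sqrt_le_iff.2 ⟨by positivity, by nlinarith⟩

theorem jap_le_add {t τ : ℝ} (h0 : 0 ≤ τ) :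
    jap t ≤ jap (t - τ) + jap τ := by
  have hsub : t - τ ≤ jap (t - τ) := Real.le_sqrt_of_sq_le (by linarith)
  have hτ : τ ≤ jap τ := Real.le_sqrt_of_sq_le (by linarith)
  refine Real.sqrt_le_iff.2 ⟨(add_pos (jap_pos _) (jap_pos _)).le, ?_⟩
  have e1 : jap (t - τ) ^ 2 = 1 + (t - τ) ^ 2 := Real.sq_sqrt (by positivity)
  have e2 : jap τ ^ 2 = 1 + τ ^ 2 := Real.sq_sqrt (by positivity)
  nlinarith [mul_le_mul hsub hτ h0 (jap_pos (t - τ)).le]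

theorem integrable_jap_rpow_neg {s : ℝ} (hs : 1 < s) :
    Integrable (fun τ : ℝ => jap τ ^ (-s)) := by
  have h := integrable_rpow_neg_one_add_norm_sq (E := ℝ) (μ := volume) (r := s) (by simpa using hs)
  refine h.congr (ae_of_all _ fun τ => ?_)
  simp only [jap, Real.norm_eq_abs, sq_abs]
  rw [Real.sqrt_eq_rpow, ← Real.rpow_mul (by positivity)]
  ring_nf

theorem integrable_indicator_rpow_neg {θ : ℝ} (hθ : θ < 1) :
    Integrable ((Ioc (0:ℝ) 1).indicator fun τ => τ ^ (-θ)) := by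
  rw [integrable_indicator_iff measurableSet_Ioc,
    ← intervalIntegrable_iff_integrableOn_Ioc_of_le zero_le_one]
  exact intervalIntegral.intervalIntegrable_rpow' (by linarith)

theorem rpow_neg_mul_rpow_neg_le {a b c s₁ s₂ : ℝ} (ha : 1 ≤ a) (hb : 1 ≤ b) (hc : 0 < c)
    (habc : c ≤ a + b) (h0 : 0 ≤ s₁) (h12 : s₁ ≤ s₂) :
    a ^ (-s₁) * b ^ (-s₂) ≤ 2 ^ s₁ * c ^ (-s₁) * max (a ^ (-s₂)) (b ^ (-s₂)) := by
  have ha0 : 0 < a := by linarith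
  have hb0 : 0 < b := by linarith
  have key : ∀ x, c ≤ 2 * x → x ^ (-s₁) ≤ 2 ^ s₁ * c ^ (-s₁) := by
    intro x hx
    have hxc : c / 2 ≤ x := by linarith
    calc x ^ (-s₁) ≤ (c / 2) ^ (-s₁) :=
          Real.rpow_le_rpow_of_nonpos (by positivity) hxc (by linarith)
      _ = 2 ^ s₁ * c ^ (-s₁) := by
          rw [Real.div_rpow hc.le zero_le_two, Real.rpow_neg zero_le_two]
          field_simp
  rcases le_total b a with h | h
  · exact mul_le_mul (key a (by linarith)) (le_max_right _ _) (by positivity) (by positivity)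
  · calc a ^ (-s₁) * b ^ (-s₂) = b ^ (-s₁) * (a ^ (-s₁) * b ^ (-(s₂ - s₁))) := by
          rw [show -s₂ = -s₁ + -(s₂ - s₁) by ring, Real.rpow_add hb0]; ring
      _ ≤ b ^ (-s₁) * (a ^ (-s₁) * a ^ (-(s₂ - s₁))) := by
          gcongr ?_ * (?_ * ?_)
          exact Real.rpow_le_rpow_of_nonpos ha0 h (by linarith)
      _ = b ^ (-s₁) * a ^ (-s₂) := by
          rw [← Real.rpow_add ha0]; ring_nf
      _ ≤ _ := mul_le_mul (key b (by linarith)) (le_max_left _ _) (by positivity) (by positivity)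

theorem rpow_neg_mul_jap_rpow_le {θ τ : ℝ} (hθ0 : 0 ≤ θ) (hθ1 : θ < 1) (hτ : 0 < τ) :
    τ ^ (-θ) * jap τ ^ θ ≤ 2 * ((Ioc (0:ℝ) 1).indicator (fun τ => τ ^ (-θ)) τ + 1) := by
  have two : (2:ℝ) ^ θ ≤ 2 := by
    simpa using Real.rpow_le_rpow_of_exponent_le one_le_two hθ1.le
  have hj := jap_le_one_add hτ.le
  rcases le_or_gt τ 1 with h | h
  · rw [indicator_of_mem (show τ ∈ Ioc (0:ℝ) 1 from ⟨hτ, h⟩)]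
    have : jap τ ^ θ ≤ 2 :=
      (Real.rpow_le_rpow (jap_pos τ).le (by linarith) hθ0).trans two
    have hp : 0 < τ ^ (-θ) := by positivity
    nlinarith
  · rw [indicator_of_notMem (fun hm : τ ∈ Ioc (0:ℝ) 1 => absurd hm.2 h.not_ge)]
    calc τ ^ (-θ) * jap τ ^ θ ≤ τ ^ (-θ) * (2 * τ) ^ θ := by
          gcongr
          · exact (jap_pos τ).le
          · linarith
      _ = 2 ^ θ := by
          rw [Real.mul_rpow zero_le_two hτ.le, Real.rpow_neg hτ.le]
          field_simp
      _ ≤ _ := by linarith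

theorem jap_convolution_integrand_le {s₁ s₂ θ t τ : ℝ} (h0 : 0 ≤ s₁) (h12 : s₁ ≤ s₂)
    (hθ0 : 0 ≤ θ) (hθ1 : θ < 1) (hτ : 0 < τ) :
    jap (t - τ) ^ (-s₁) * τ ^ (-θ) * jap τ ^ (θ - s₂) ≤
      2 * 2 ^ s₁ * jap t ^ (-s₁) * ((Ioc (0:ℝ) 1).indicator (fun τ => τ ^ (-θ)) τ
        + (jap (t - τ) ^ (-s₂) + jap τ ^ (-s₂))) := by
  have hR := rpow_neg_mul_jap_rpow_le hθ0 hθ1 hτ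
  have hM := rpow_neg_mul_rpow_neg_le (one_le_jap (t - τ)) (one_le_jap τ) (jap_pos t)
    (jap_le_add hτ.le) h0 h12
  have ha : 0 < jap (t - τ) ^ (-s₂) := Real.rpow_pos_of_pos (jap_pos _) _
  have hb : 0 < jap τ ^ (-s₂) := Real.rpow_pos_of_pos (jap_pos _) _
  have hM1 : max (jap (t - τ) ^ (-s₂)) (jap τ ^ (-s₂)) ≤ 1 := max_le
    (Real.rpow_le_one_of_one_le_of_nonpos (one_le_jap _) (by linarith))
    (Real.rpow_le_one_of_one_le_of_nonpos (one_le_jap _) (by linarith))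
  have hM2 := max_le_add_of_nonneg ha.le hb.le
  have hk : 0 ≤ (Ioc (0:ℝ) 1).indicator (fun τ => τ ^ (-θ)) τ :=
    indicator_nonneg (fun x hx => Real.rpow_nonneg hx.1.le _) τ
  have hc : 0 < jap t ^ (-s₁) := Real.rpow_pos_of_pos (jap_pos _) _
  have hp : 0 ≤ jap (t - τ) ^ (-s₁) * jap τ ^ (-s₂) :=
    mul_nonneg (Real.rpow_nonneg (jap_pos _).le _) hb.le
  generalize (Ioc (0:ℝ) 1).indicator (fun τ => τ ^ (-θ)) τ = k at *
  generalize max (jap (t - τ) ^ (-s₂)) (jap τ ^ (-s₂)) = M at *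
  calc jap (t - τ) ^ (-s₁) * τ ^ (-θ) * jap τ ^ (θ - s₂)
      = (τ ^ (-θ) * jap τ ^ θ) * (jap (t - τ) ^ (-s₁) * jap τ ^ (-s₂)) := by
        rw [sub_eq_add_neg θ, Real.rpow_add (jap_pos τ)]; ring
    _ ≤ (2 * (k + 1)) * (2 ^ s₁ * jap t ^ (-s₁) * M) := by gcongr
    _ = 2 * 2 ^ s₁ * jap t ^ (-s₁) * (k * M + M) := by ring
    _ ≤ _ := by
        gcongr
        exact mul_le_of_le_one_right hk hM1

/-- `∫₀ᵗ ⟨t−τ⟩^{−s₁} τ^{−θ} ⟨τ⟩^{θ−s₂} dτ ≤ C ⟨t⟩^{−s₁}` for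
`0 ≤ s₁ ≤ s₂`, `s₂ > 1`, `0 ≤ θ < 1`. -/
theorem stmt13 (s₁ s₂ θ : ℝ) (h0 : 0 ≤ s₁) (h12 : s₁ ≤ s₂) (h2 : 1 < s₂)
    (hθ0 : 0 ≤ θ) (hθ1 : θ < 1) :
    ∃ C > (0:ℝ), ∀ t : ℝ, 0 ≤ t →
      (∫ τ in (0:ℝ)..t, jap (t - τ) ^ (-s₁) * τ ^ (-θ) * jap τ ^ (θ - s₂))
        ≤ C * jap t ^ (-s₁) := by
  set k : ℝ → ℝ := (Ioc (0:ℝ) 1).indicator fun τ => τ ^ (-θ)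
  have hk : Integrable k := integrable_indicator_rpow_neg hθ1
  have hk0 : ∀ τ, 0 ≤ k τ := indicator_nonneg fun x hx => Real.rpow_nonneg hx.1.le _
  have hJ := integrable_jap_rpow_neg h2
  have hJ0 : ∀ τ, 0 ≤ jap τ ^ (-s₂) := fun τ => Real.rpow_nonneg (jap_pos τ).le _
  set A : ℝ := (∫ τ, k τ) + ((∫ τ, jap τ ^ (-s₂)) + ∫ τ, jap τ ^ (-s₂))
  have hA : 0 ≤ A := add_nonneg (integral_nonneg hk0)
    (add_nonneg (integral_nonneg hJ0) (integral_nonneg hJ0))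
  refine ⟨2 * 2 ^ s₁ * (A + 1), by positivity, fun t ht => ?_⟩
  have hc : 0 < jap t ^ (-s₁) := Real.rpow_pos_of_pos (jap_pos _) _
  have hJt : Integrable fun τ => jap (t - τ) ^ (-s₂) := hJ.comp_sub_left t
  have hJs : Integrable fun τ => jap (t - τ) ^ (-s₂) + jap τ ^ (-s₂) := hJt.add hJ
  set G : ℝ → ℝ := fun τ => 2 * 2 ^ s₁ * jap t ^ (-s₁) *
    (k τ + (jap (t - τ) ^ (-s₂) + jap τ ^ (-s₂)))
  have hG : Integrable G := (hk.add hJs).const_mul _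
  have hG0 : ∀ τ, 0 ≤ G τ := fun τ =>
    mul_nonneg (by positivity) (add_nonneg (hk0 τ) (add_nonneg (hJ0 _) (hJ0 τ)))
  rw [intervalIntegral.integral_of_le ht]
  calc ∫ τ in Ioc 0 t, jap (t - τ) ^ (-s₁) * τ ^ (-θ) * jap τ ^ (θ - s₂)
      ≤ ∫ τ in Ioc 0 t, G τ := by
        refine integral_mono_of_nonneg ?_ hG.integrableOn ?_
        · filter_upwards [ae_restrict_mem measurableSet_Ioc] with τ hτ
          exact mul_nonneg (mul_nonneg (Real.rpow_nonneg (jap_pos _).le _)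
            (Real.rpow_nonneg hτ.1.le _)) (Real.rpow_nonneg (jap_pos _).le _)
        · filter_upwards [ae_restrict_mem measurableSet_Ioc] with τ hτ
          exact jap_convolution_integrand_le h0 h12 hθ0 hθ1 hτ.1
    _ ≤ ∫ τ, G τ := setIntegral_le_integral hG (ae_of_all _ hG0)
    _ = 2 * 2 ^ s₁ * jap t ^ (-s₁) * A := by
        rw [integral_const_mul, integral_add hk hJs, integral_add hJt hJ,
          integral_sub_left_eq_self (fun τ => jap τ ^ (-s₂)) volume t]
    _ ≤ 2 * 2 ^ s₁ * (A + 1) * jap t ^ (-s₁) := by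
        have : 0 < 2 * 2 ^ s₁ * jap t ^ (-s₁) := by positivity
        linarith
end
end
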